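/- For n ∈ {1, 2, 3}, the friendship graph F_n is determined by its adjacency spectrum: every graph cospectral with F_n is isomorphic to F_n. -/

import Mathlib

open Polynomial

/-- The adjacency matrix of a simple graph, with entries in `R`. -/
noncomputable def adjMat (R : Type*) [Zero R] [One R] {V : Type*} [Fintype V]
    (G : SimpleGraph V) : Matrix V V R :=
  letI := Classical.decRel G.Adj
  G.adjMatrix R

/-- The friendship graph `F n`: `n` triangles glued at the common vertex `none`. -/
def friendshipGraph (n : ℕ) : SimpleGraph (Option (Fin n × Bool)) :=
  SimpleGraph.fromRel (fun u v =>
    u = none ∨ ∃ i : Fin n, u = some (i, true) ∧ v = some (i, false))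

/-- Two finite graphs are cospectral if their real adjacency matrices have the same
characteristic polynomial. -/
def Cospectral {V W : Type*} [Fintype V] [Fintype W] [DecidableEq V] [DecidableEq W]
    (G : SimpleGraph V) (H : SimpleGraph W) : Prop :=
  (adjMat ℝ G).charpoly = (adjMat ℝ H).charpoly

/-! ### Cospectral graphs and the square of the adjacency matrix -/

open Matrix in
/-- Real symmetric matrices with equal characteristic polynomials are orthogonally similar. -/
theorem exists_unitary_conj_of_charpoly_eq {W : Type*} [Fintype W] [DecidableEq W]
    {A B : Matrix W W ℝ} (hA : A.IsHermitian) (hB : B.IsHermitian)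
    (h : A.charpoly = B.charpoly) :
    ∃ U : Matrix W W ℝ, star U * U = 1 ∧ U * star U = 1 ∧ A = U * B * star U := by
  have he := (hA.eigenvalues_eq_eigenvalues_iff hB).2 h
  have h1 := hA.spectral_theorem
  have h2 := hB.conjStarAlgAut_star_eigenvectorUnitary
  rw [Unitary.conjStarAlgAut_apply] at h1 h2
  rw [he, ← h2] at h1
  refine ⟨hA.eigenvectorUnitary * star (hB.eigenvectorUnitary : Matrix W W ℝ), ?_, ?_, ?_⟩
  · rw [star_mul, star_star]
    calc _ = (hB.eigenvectorUnitary : Matrix W W ℝ) *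
          (star (hA.eigenvectorUnitary : Matrix W W ℝ) * hA.eigenvectorUnitary) *
          star (hB.eigenvectorUnitary : Matrix W W ℝ) := by simp only [Matrix.mul_assoc]
      _ = 1 := by simp
  · rw [star_mul, star_star]
    calc _ = (hA.eigenvectorUnitary : Matrix W W ℝ) *
          (star (hB.eigenvectorUnitary : Matrix W W ℝ) * hB.eigenvectorUnitary) *
          star (hA.eigenvectorUnitary : Matrix W W ℝ) := by simp only [Matrix.mul_assoc]
      _ = 1 := by simp
  · conv_lhs => rw [h1]
    simp [Matrix.mul_assoc]

theorem adjMat_apply {V : Type*} [Fintype V] (G : SimpleGraph V) [DecidableRel G.Adj] (i j : V) :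
    adjMat ℝ G i j = if G.Adj i j then 1 else 0 := by
  simp [adjMat, SimpleGraph.adjMatrix_apply]

theorem adjMat_isHermitian {V : Type*} [Fintype V] (G : SimpleGraph V) :
    (adjMat ℝ G).IsHermitian := by
  classical
  ext i j
  simp [adjMat_apply, G.adj_comm]

theorem friendshipGraph_adj_none_some {n : ℕ} (x : Fin n × Bool) :
    (friendshipGraph n).Adj none (some x) := by
  simp [friendshipGraph]

theorem friendshipGraph_adj_some_some {n : ℕ} (x y : Fin n × Bool) :
    (friendshipGraph n).Adj (some x) (some y) ↔ y = (x.1, !x.2) := by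
  obtain ⟨i, a⟩ := x
  obtain ⟨j, b⟩ := y
  cases a <;> cases b <;> simp [friendshipGraph, SimpleGraph.fromRel_adj, eq_comm]

/-- The adjacency matrix of the friendship graph, in coordinates. -/
theorem adjMat_friendshipGraph (n : ℕ) (u v : Option (Fin n × Bool)) :
    adjMat ℝ (friendshipGraph n) u v =
      match u, v with
      | none, none => 0
      | none, some _ => 1
      | some _, none => 1
      | some x, some y => if y = (x.1, !x.2) then 1 else 0 := by
  classical
  rw [adjMat_apply]
  cases u <;> cases v
  · simp
  · simp [friendshipGraph_adj_none_some]
  · simp [(friendshipGraph_adj_none_some _).symm]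
  · simp [friendshipGraph_adj_some_some]

theorem adjMat_friendshipGraph_mul_self_apply (n : ℕ) (u v : Option (Fin n × Bool)) :
    (adjMat ℝ (friendshipGraph n) * adjMat ℝ (friendshipGraph n)) u v =
      (if u = v then 1 else 0) + 1 +
        (2 * n - 2) * ((if u = none then 1 else 0) * (if v = none then 1 else 0)) := by
  simp only [Matrix.mul_apply, Fintype.sum_option, adjMat_friendshipGraph]
  have h (y z : Fin n × Bool) : y = (z.1, !z.2) ↔ z = (y.1, !y.2) := by
    aesop
  rcases u with _ | x <;> rcases v with _ | y
  · simp
    ring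
  · simp [h]
  · simp
  · have h' : (y.1, !y.2) = (x.1, !x.2) ↔ x = y := by
      aesop
    simp [h, h', add_comm]

theorem trace_sq_friendshipGraph (n : ℕ) :
    (adjMat ℝ (friendshipGraph n) * adjMat ℝ (friendshipGraph n)).trace = 6 * n := by
  simp only [Matrix.trace, Matrix.diag, adjMat_friendshipGraph_mul_self_apply]
  simp [Fintype.sum_option]
  ring

theorem trace_cube_friendshipGraph (n : ℕ) :
    (adjMat ℝ (friendshipGraph n) * (adjMat ℝ (friendshipGraph n) *
      adjMat ℝ (friendshipGraph n))).trace = 6 * n := by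
  simp only [Matrix.trace, Matrix.diag, Matrix.mul_apply (M := adjMat ℝ _) (N := _ * _),
    adjMat_friendshipGraph_mul_self_apply]
  have h (x : Fin n × Bool) : x ≠ (x.1, !x.2) := by
    simp [Prod.ext_iff]
  simp [Fintype.sum_option, adjMat_friendshipGraph, h, mul_add, Finset.sum_add_distrib]
  ring

/-- The common consequences of cospectrality with a friendship graph: `A ^ 2 - 1` has rank at most
two and is positive semidefinite, and the graph has the right numbers of edges and triangles. -/
theorem Cospectral.exists_mul_self_apply {V : Type*} [Fintype V] [DecidableEq V] {n : ℕ}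
    (hn : 1 ≤ n) {G : SimpleGraph V} (h : Cospectral G (friendshipGraph n)) :
    Fintype.card V = 2 * n + 1 ∧
    (∃ p q : V → ℝ, ∀ i j, (adjMat ℝ G * adjMat ℝ G) i j =
      (if i = j then 1 else 0) + p i * p j + q i * q j) ∧
    (adjMat ℝ G * adjMat ℝ G).trace = 6 * n ∧
    (adjMat ℝ G * (adjMat ℝ G * adjMat ℝ G)).trace = 6 * n := by
  have hcard : Fintype.card V = Fintype.card (Option (Fin n × Bool)) := by
    have := congrArg Polynomial.natDegree h
    simpa only [Matrix.charpoly_natDegree_eq_dim] using this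
  refine ⟨by simp [hcard, mul_comm], ?_⟩
  let e := Fintype.equivOfCardEq hcard
  obtain ⟨U, hU, hU', hA⟩ := exists_unitary_conj_of_charpoly_eq
    (A := Matrix.reindex e e (adjMat ℝ G)) (B := adjMat ℝ (friendshipGraph n))
    ((adjMat_isHermitian G).submatrix _) (adjMat_isHermitian _)
    (by rw [Matrix.charpoly_reindex]; exact h)
  set A := adjMat ℝ G
  set B := adjMat ℝ (friendshipGraph n) with hB
  set R := Matrix.reindex e e A with hR
  have hAR : A = R.submatrix e e := by simp [hR]
  have hRR : R * R = U * (B * B) * star U := by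
    calc R * R = U * B * (star U * U) * B * star U := by rw [hA]; simp only [Matrix.mul_assoc]
      _ = _ := by rw [hU]; simp only [Matrix.mul_assoc, Matrix.one_mul]
  have hRRR : R * (R * R) = U * (B * (B * B)) * star U := by
    calc R * (R * R) = U * B * (star U * U) * (B * B) * star U := by
          rw [hRR, hA]; simp only [Matrix.mul_assoc]
      _ = _ := by rw [hU]; simp only [Matrix.mul_assoc, Matrix.one_mul]
  have htr (M : Matrix V V ℝ) (N : Matrix (Option (Fin n × Bool)) (Option (Fin n × Bool)) ℝ)
      (hM : M = N.submatrix e e) : M.trace = N.trace := by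
    rw [hM]
    exact e.sum_comp fun i => N i i
  have hAA : A * A = (R * R).submatrix e e := by
    rw [hAR, Matrix.submatrix_mul_equiv]
  have hAAA : A * (A * A) = (R * (R * R)).submatrix e e := by
    rw [hAA, hAR, Matrix.submatrix_mul_equiv]
  refine ⟨?_, ?_, ?_⟩
  · refine ⟨fun i => ∑ k, U (e i) k, fun i => √(2 * n - 2) * U (e i) none, fun i j => ?_⟩
    have hn' : (0 : ℝ) ≤ 2 * n - 2 := by
      have : (1 : ℝ) ≤ n := by exact_mod_cast hn
      linarith
    have hs := Real.mul_self_sqrt hn'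
    have h1 : ∑ k, U (e i) k * U (e j) k = if i = j then 1 else 0 := by
      have := congrFun (congrFun hU' (e i)) (e j)
      simpa [Matrix.mul_apply, Matrix.one_apply] using this
    rw [hAA, Matrix.submatrix_apply, hRR, Matrix.mul_apply]
    simp only [Matrix.mul_apply (M := U), hB, adjMat_friendshipGraph_mul_self_apply, Matrix.star_apply,
      star_trivial]
    rw [← h1, Finset.sum_mul_sum, Finset.sum_comm]
    have h2 : √(2 * n - 2) * U (e i) none * (√(2 * n - 2) * U (e j) none) =
        (2 * n - 2) * U (e i) none * U (e j) none := by
      linear_combination (U (e i) none * U (e j) none) * hs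
    rw [h2]
    simp [mul_add, add_mul, Finset.sum_add_distrib, Finset.sum_mul,
      -mul_eq_mul_right_iff]
    ring
  · rw [htr _ _ hAA, hRR, Matrix.trace_mul_comm, ← Matrix.mul_assoc, hU, Matrix.one_mul,
      trace_sq_friendshipGraph]
  · rw [htr _ _ hAAA, hRRR, Matrix.trace_mul_comm, ← Matrix.mul_assoc, hU, Matrix.one_mul,
      trace_cube_friendshipGraph]

/-! ### Recognizing the friendship graph -/

/-- A fixed-point-free involution of a set with `2 * n` elements is the exchange of the two copies
of an `n`-element set. -/
theorem exists_equiv_prod_bool_of_involutive {X : Type*} [Fintype X] {n : ℕ}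
    (hX : Fintype.card X = 2 * n) {σ : X → X} (hσ : Function.Involutive σ)
    (hne : ∀ x, σ x ≠ x) :
    ∃ e : X ≃ Fin n × Bool, ∀ x, e (σ x) = ((e x).1, !(e x).2) := by
  classical
  let f := Fintype.equivFin X
  let S := {x : X // f x < f (σ x)}
  let g : S × Bool → X := fun s => if s.2 then s.1 else σ s.1
  have hg (s : S) (b : Bool) : σ (g (s, b)) = g (s, !b) := by
    cases b <;> simp [g, hσ s.1]
  have hinj : Function.Injective g := by
    rintro ⟨⟨s, hs⟩, a⟩ ⟨⟨t, ht⟩, b⟩ h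
    cases a <;> cases b <;> simp only [g] at h
    · exact congrArg (·, false) (Subtype.ext (hσ.injective h))
    · simp only [if_true, Bool.false_eq_true, if_false] at h
      rw [← h, hσ s] at ht
      exact absurd hs ht.asymm
    · simp only [if_true, Bool.false_eq_true, if_false] at h
      rw [h, hσ t] at hs
      exact absurd ht hs.asymm
    · exact congrArg (·, true) (Subtype.ext h)
  have hsurj : Function.Surjective g := by
    intro x
    rcases lt_trichotomy (f x) (f (σ x)) with h | h | h
    · exact ⟨(⟨x, h⟩, true), rfl⟩
    · exact absurd (f.injective h).symm (hne x)
    · exact ⟨(⟨σ x, by rwa [hσ x]⟩, false), hσ x⟩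
  let E := Equiv.ofBijective g ⟨hinj, hsurj⟩
  have hS : Fintype.card S = Fintype.card (Fin n) := by
    have := Fintype.card_congr E
    simp only [Fintype.card_prod, Fintype.card_bool, hX] at this
    rw [Fintype.card_fin]
    omega
  let k := Fintype.equivOfCardEq hS
  refine ⟨E.symm.trans (k.prodCongr (Equiv.refl Bool)), fun x => ?_⟩
  obtain ⟨⟨s, b⟩, rfl⟩ := E.surjective x
  have : σ (E (s, b)) = E (s, !b) := hg s b
  simp [this]

/-- A graph on `2 * n + 1` vertices with a universal vertex and all other degrees equal to `2`
is the friendship graph. -/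
theorem nonempty_iso_friendshipGraph_of_degree {V : Type*} [Fintype V] (G : SimpleGraph V)
    [DecidableRel G.Adj] {n : ℕ} (hV : Fintype.card V = 2 * n + 1) {c : V}
    (hc : G.degree c = 2 * n) (hdeg : ∀ v, v ≠ c → G.degree v = 2) :
    Nonempty (G ≃g friendshipGraph n) := by
  classical
  have hadj (v : V) (hv : v ≠ c) : G.Adj c v := by
    have h1 : G.neighborFinset c ⊆ Finset.univ.erase c := fun w hw => by
      simpa using (G.ne_of_adj ((G.mem_neighborFinset c w).1 hw)).symm
    have h2 := Finset.eq_of_subset_of_card_le h1 (by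
      rw [Finset.card_erase_of_mem (Finset.mem_univ c), Finset.card_univ, hV,
        G.card_neighborFinset_eq_degree, hc, Nat.add_sub_cancel])
    rw [← G.mem_neighborFinset, h2]
    simpa using hv
  have hpartner (v : {v : V // v ≠ c}) :
      ∃ w : {v : V // v ≠ c}, ∀ u : {v : V // v ≠ c}, G.Adj v u ↔ u = w := by
    have h1 : ((G.neighborFinset v).erase c).card = 1 := by
      rw [Finset.card_erase_of_mem ((G.mem_neighborFinset _ _).2 (hadj v v.2).symm),
        G.card_neighborFinset_eq_degree, hdeg v v.2]
    obtain ⟨w, hw⟩ := Finset.card_eq_one.1 h1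
    have hmem (u : V) : u ≠ c ∧ G.Adj v u ↔ u = w := by
      rw [← Finset.mem_singleton, ← hw, Finset.mem_erase, G.mem_neighborFinset]
    refine ⟨⟨w, ((hmem w).2 rfl).1⟩, fun u => ?_⟩
    rw [Subtype.ext_iff, ← hmem u]
    simp [u.2]
  choose σ hσ using hpartner
  have hinv : Function.Involutive σ := fun v =>
    ((hσ (σ v) v).1 ((hσ v (σ v)).2 rfl).symm).symm
  have hne (v : {v : V // v ≠ c}) : σ v ≠ v := fun h =>
    G.loopless.irrefl (v : V) ((hσ v v).2 h.symm)
  obtain ⟨e, he⟩ := exists_equiv_prod_bool_of_involutive (n := n)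
    (by rw [Fintype.card_subtype_compl, Fintype.card_subtype_eq, hV, Nat.add_sub_cancel]) hinv hne
  let E : Option {v : V // v ≠ c} ≃ V := Equiv.optionSubtypeNe c
  have hnone : E none = c := rfl
  have hsome (x : {v : V // v ≠ c}) : E (some x) = x := rfl
  refine ⟨(⟨E.symm.trans (Equiv.optionCongr e), fun {u v} => ?_⟩ : G ≃g friendshipGraph n)⟩
  obtain ⟨x, rfl⟩ := E.surjective u
  obtain ⟨y, rfl⟩ := E.surjective v
  simp only [Equiv.trans_apply, Equiv.symm_apply_apply]
  rcases x with _ | x <;> rcases y with _ | y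
  · simp
  · simpa [hnone, hsome, friendshipGraph_adj_none_some] using hadj y y.2
  · simpa [hnone, hsome, (friendshipGraph_adj_none_some _).symm] using (hadj x x.2).symm
  · simp [hsome, friendshipGraph_adj_some_some, hσ, ← he]

/-! ### Searching for symmetric Boolean matrices row by row -/

/-- The number of positions at which both lists are `true`. -/
def dotCount : List Bool → List Bool → ℕ
  | a :: l, b :: m => (a && b).toNat + dotCount l m
  | _, _ => 0

/-- Whether `p` holds for all Boolean lists of length `m`. -/
def allBits : ℕ → (List Bool → Bool) → Bool
  | 0, p => p []
  | m + 1, p => allBits m (fun l => p (true :: l)) && allBits m (fun l => p (false :: l))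

/-- The value `p l`, computed after evaluating all entries of `l`. -/
def evalBits : List Bool → (List Bool → Bool) → Bool
  | [], p => p []
  | b :: l, p => evalBits l fun m => bif b then p (true :: m) else p (false :: m)

/-- Whether `concl` holds for all symmetric Boolean matrices with zero diagonal that extend the
given rows by `m` further rows and whose initial blocks of rows all satisfy `ok`. Rows are listed
in reverse order. -/
def search (ok concl : List (List Bool) → Bool) : ℕ → List (List Bool) → Bool
  | 0, rows => concl rows
  | m + 1, rows => allBits m fun l =>
    evalBits (rows.reverse.map (·.getD rows.length false) ++ false :: l) fun r =>
      !ok (r :: rows) || search ok concl m (r :: rows)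

/-- Whether `(x - 1, a, b; a, y - 1, c; b, c, z - 1)` is a singular matrix. -/
def isSingular (x y z a b c : ℕ) : Bool :=
  ((x - 1) * (y - 1) * (z - 1) + 2 * a * b * c).beq
    ((x - 1) * (c * c) + (y - 1) * (b * b) + (z - 1) * (a * a))

/-- Whether the Gram matrix of each triple of rows including `r`, minus the identity, is
singular. -/
def singularWith (r : List Bool) : List (List Bool) → Bool
  | [] => true
  | s :: rows => (rows.all fun t => isSingular (dotCount r r) (dotCount s s) (dotCount t t)
      (dotCount r s) (dotCount r t) (dotCount s t)) && singularWith r rows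

/-- The restrictions imposed by the first row of the list, which is the last row of the block: the
initial row of the block has the largest sum, and its ones precede its zeros off the diagonal. -/
def admissible : List (List Bool) → Bool
  | [] => true
  | [r] => decide (r.tail.Pairwise fun a b => b ≤ a) && Nat.ble 1 (dotCount r r)
  | r :: rows => Nat.ble 1 (dotCount r r) &&
      Nat.ble (dotCount r r) (dotCount (rows.getLastD r) (rows.getLastD r)) && singularWith r rows

/-- If the matrix with the given (reversed) rows has `6 * n` ones and the trace of its cube is
`6 * n`, then its row sums are those of the friendship graph. -/
def friendshipDegrees (n : ℕ) (rows : List (List Bool)) : Bool :=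
  let rows := rows.reverse
  let d := rows.map fun r => dotCount r r
  !(d.sum == 6 * n) ||
  !((rows.map fun r =>
    (List.zipWith (fun b s => bif b then dotCount r s else 0) r rows).sum).sum == 6 * n) ||
  (List.range (2 * n + 1)).any fun c => (List.range (2 * n + 1)).all fun v =>
    d.getD v 0 == bif v == c then 2 * n else 2

theorem evalBits_eq (l : List Bool) (p : List Bool → Bool) : evalBits l p = p l := by
  induction l generalizing p with
  | nil => rfl
  | cons b l ih => cases b <;> simp [evalBits, ih]

theorem apply_of_allBits {m : ℕ} {p : List Bool → Bool} (h : allBits m p = true)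
    {l : List Bool} (hl : l.length = m) : p l = true := by
  induction m generalizing p l with
  | zero => rwa [List.length_eq_zero_iff.1 hl]
  | succ m ih =>
    obtain ⟨b, l, rfl⟩ := List.exists_cons_of_length_eq_add_one hl
    simp only [allBits, Bool.and_eq_true] at h
    simp only [List.length_cons, Nat.add_right_cancel_iff] at hl
    cases b
    · exact ih h.2 hl
    · exact ih h.1 hl

/-- The `i`-th row of the `N × N` block of `A`. -/
def rowList (A : ℕ → ℕ → Bool) (N i : ℕ) : List Bool :=
  (List.range N).map (A i)

/-- The first `k` rows of the `N × N` block of `A`, in reverse order. -/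
def reverseRows (A : ℕ → ℕ → Bool) (N k : ℕ) : List (List Bool) :=
  ((List.range k).map (rowList A N)).reverse

theorem reverseRows_succ (A : ℕ → ℕ → Bool) (N k : ℕ) :
    reverseRows A N (k + 1) = rowList A N k :: reverseRows A N k := by
  simp [reverseRows, List.range_succ]

theorem mem_reverseRows {A : ℕ → ℕ → Bool} {N k : ℕ} {r : List Bool} :
    r ∈ reverseRows A N k ↔ ∃ i < k, rowList A N i = r := by
  simp [reverseRows]

theorem concl_of_search {ok concl : List (List Bool) → Bool} {A : ℕ → ℕ → Bool} {N : ℕ}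
    (hsymm : ∀ i j, A i j = A j i) (hirr : ∀ i, A i i = false)
    (hok : ∀ k ≤ N, ok (reverseRows A N k) = true) (h : search ok concl N [] = true) :
    concl (reverseRows A N N) = true := by
  suffices key : ∀ m k, k + m = N → search ok concl m (reverseRows A N k) = true →
      concl (reverseRows A N N) = true from key N 0 (Nat.zero_add N) h
  intro m
  induction m with
  | zero =>
    rintro k rfl h
    exact h
  | succ m ih =>
    rintro k rfl h
    have hrow : rowList A (k + (m + 1)) k =
        (reverseRows A (k + (m + 1)) k).reverse.map
          (·.getD (reverseRows A (k + (m + 1)) k).length false) ++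
        false :: (List.range m).map fun j => A k (k + (j + 1)) := by
      conv_lhs => rw [rowList, List.range_add, List.map_append, List.range_succ_eq_map]
      congr 1
      · simp only [reverseRows, List.reverse_reverse, List.map_map, List.length_reverse,
          List.length_map, List.length_range]
        refine List.map_congr_left fun i _ => ?_
        simp [rowList, hsymm k i]
      · simp [hirr, Function.comp_def]
    have h1 := apply_of_allBits h
      (l := (List.range m).map fun j => A k (k + (j + 1))) (by simp)
    simp only [evalBits_eq] at h1
    rw [← hrow, ← reverseRows_succ, hok _ (by omega)] at h1
    exact ih (k + 1) (by omega) (by simpa using h1)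

theorem dotCount_map (l : List ℕ) (f g : ℕ → Bool) :
    dotCount (l.map f) (l.map g) = (l.map fun k => (f k && g k).toNat).sum := by
  induction l with
  | nil => rfl
  | cons a l ih => simp [dotCount, ih]

/-- The number of common ones of the rows `i` and `j` of the `N × N` block of `A`. -/
def commonOnes (A : ℕ → ℕ → Bool) (N i j : ℕ) : ℕ :=
  ∑ k ∈ Finset.range N, (A i k && A j k).toNat

theorem dotCount_rowList (A : ℕ → ℕ → Bool) (N i j : ℕ) :
    dotCount (rowList A N i) (rowList A N j) = commonOnes A N i j := by
  rw [rowList, rowList, dotCount_map]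
  rfl

theorem singularWith_reverseRows {A : ℕ → ℕ → Bool} {N i k : ℕ}
    (h : ∀ l j, l < j → j < k → isSingular (commonOnes A N i i) (commonOnes A N j j)
      (commonOnes A N l l) (commonOnes A N i j) (commonOnes A N i l) (commonOnes A N j l) = true) :
    singularWith (rowList A N i) (reverseRows A N k) = true := by
  induction k with
  | zero => rfl
  | succ k ih =>
    simp only [reverseRows_succ, singularWith, Bool.and_eq_true, List.all_eq_true,
      mem_reverseRows, dotCount_rowList]
    refine ⟨?_, ih fun l j hl hj => h l j hl (by omega)⟩
    rintro _ ⟨l, hl, rfl⟩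
    simpa only [dotCount_rowList] using h l k hl (by omega)

theorem admissible_reverseRows {A : ℕ → ℕ → Bool} {N k : ℕ} (hk : k ≤ N)
    (hpos : ∀ i < N, 1 ≤ commonOnes A N i i)
    (hmax : ∀ i < N, commonOnes A N i i ≤ commonOnes A N 0 0)
    (hmono : ∀ i j, 0 < i → i < j → j < N → A 0 j ≤ A 0 i)
    (hsing : ∀ l j i, l < j → j < i → i < N →
      isSingular (commonOnes A N i i) (commonOnes A N j j) (commonOnes A N l l)
        (commonOnes A N i j) (commonOnes A N i l) (commonOnes A N j l) = true) :
    admissible (reverseRows A N k) = true := by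
  match k with
  | 0 => rfl
  | 1 =>
    have hrow : reverseRows A N 1 = [rowList A N 0] := rfl
    rw [hrow]
    simp only [admissible, Bool.and_eq_true, decide_eq_true_eq, Nat.ble_eq, dotCount_rowList]
    refine ⟨?_, hpos 0 hk⟩
    obtain ⟨m, rfl⟩ := Nat.exists_eq_add_of_le' hk
    rw [rowList, List.range_succ_eq_map, List.map_cons, List.tail_cons, List.map_map,
      List.pairwise_map]
    refine List.pairwise_lt_range.imp_of_mem fun {i j} _ hj hij => ?_
    rw [List.mem_range] at hj
    exact hmono (i + 1) (j + 1) (by omega) (by omega) (by omega)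
  | k + 2 =>
    have hlast : (reverseRows A N (k + 1)).getLastD (rowList A N (k + 1)) = rowList A N 0 := by
      simp [reverseRows, List.range_succ_eq_map]
    have h := singularWith_reverseRows (A := A) (N := N) (i := k + 1) (k := k + 1)
      fun l j hl hj => hsing l j (k + 1) hl hj hk
    rw [reverseRows_succ] at hlast h
    simp only [reverseRows_succ, admissible, Bool.and_eq_true, Nat.ble_eq]
    rw [hlast]
    simp only [dotCount_rowList]
    exact ⟨⟨hpos _ hk, hmax _ hk⟩, h⟩

theorem exists_of_friendshipDegrees {A : ℕ → ℕ → Bool} {n : ℕ}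
    (h : friendshipDegrees n (reverseRows A (2 * n + 1) (2 * n + 1)) = true)
    (h₂ : ∑ i ∈ Finset.range (2 * n + 1), commonOnes A (2 * n + 1) i i = 6 * n)
    (h₃ : ∑ i ∈ Finset.range (2 * n + 1), ∑ j ∈ Finset.range (2 * n + 1),
      (A i j).toNat * commonOnes A (2 * n + 1) i j = 6 * n) :
    ∃ c < 2 * n + 1, ∀ v < 2 * n + 1,
      commonOnes A (2 * n + 1) v v = if v = c then 2 * n else 2 := by
  generalize hN : 2 * n + 1 = N at h h₂ h₃ ⊢
  have e₂ : (((List.range N).map (rowList A N)).map fun r => dotCount r r) =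
      (List.range N).map fun i => commonOnes A N i i := by
    simp [dotCount_rowList]
  have e₃ : (((List.range N).map (rowList A N)).map fun r => (List.zipWith
      (fun b s => bif b then dotCount r s else 0) r ((List.range N).map (rowList A N))).sum).sum =
      6 * n := by
    rw [← h₃, List.map_map]
    change _ = ((List.range N).map fun i =>
      ((List.range N).map fun j => (A i j).toNat * commonOnes A N i j).sum).sum
    congr 1
    refine List.map_congr_left fun i _ => ?_
    simp only [Function.comp_apply]
    congr 1
    conv_lhs => rw [rowList, List.zipWith_map, List.zipWith_self]
    refine List.map_congr_left fun j _ => ?_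
    change (bif A i j then dotCount (rowList A N i) (rowList A N j) else 0) = _
    rw [dotCount_rowList]
    cases A i j <;> simp
  have h₂' : ((List.range N).map fun i => commonOnes A N i i).sum = 6 * n := h₂
  rw [friendshipDegrees] at h
  simp only [reverseRows, List.reverse_reverse, e₂, e₃, h₂', hN] at h
  simp only [beq_self_eq_true, Bool.not_true, Bool.false_or, List.any_eq_true, List.all_eq_true,
    List.mem_range, beq_iff_eq] at h
  obtain ⟨c, hc, h⟩ := h
  refine ⟨c, hc, fun v hv => ?_⟩
  have hval := h v hv
  simpa [hv, Bool.cond_eq_ite] using hval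

theorem exists_equiv_fin_monotone {V : Type*} [Fintype V] {N : ℕ} (hV : Fintype.card V = N)
    (key : V → ℕ) : ∃ e : V ≃ Fin N, Monotone (key ∘ e.symm) :=
  ⟨(Fintype.equivFinOfCardEq hV).trans
    (Tuple.sort (key ∘ (Fintype.equivFinOfCardEq hV).symm)).symm,
    Tuple.monotone_sort (key ∘ (Fintype.equivFinOfCardEq hV).symm)⟩

theorem adjMat_mul_self_apply {V : Type*} [Fintype V] (G : SimpleGraph V) [DecidableRel G.Adj]
    (a b : V) : (adjMat ℝ G * adjMat ℝ G) a b =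
      ((∑ v, (decide (G.Adj a v) && decide (G.Adj b v)).toNat : ℕ) : ℝ) := by
  rw [Matrix.mul_apply, Nat.cast_sum]
  refine Finset.sum_congr rfl fun v _ => ?_
  rw [adjMat_apply, adjMat_apply]
  by_cases h₁ : G.Adj a v <;> by_cases h₂ : G.Adj b v <;> simp [h₁, h₂, G.adj_comm v b]

theorem isSingular_of_cast_eq {x y z a b c : ℕ} (hx : 1 ≤ x) (hy : 1 ≤ y) (hz : 1 ≤ z)
    {p q : Fin 3 → ℝ} (hx' : (x : ℝ) = 1 + p 0 * p 0 + q 0 * q 0)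
    (hy' : (y : ℝ) = 1 + p 1 * p 1 + q 1 * q 1) (hz' : (z : ℝ) = 1 + p 2 * p 2 + q 2 * q 2)
    (ha : (a : ℝ) = p 0 * p 1 + q 0 * q 1) (hb : (b : ℝ) = p 0 * p 2 + q 0 * q 2)
    (hc : (c : ℝ) = p 1 * p 2 + q 1 * q 2) : isSingular x y z a b c = true := by
  rw [isSingular, Nat.beq_eq]
  rify [hx, hy, hz]
  rw [hx', hy', hz', ha, hb, hc]
  ring

/-- The adjacency matrix of a graph with numbered vertices, extended by zeros. -/
theorem exists_bool_matrix {V : Type*} (G : SimpleGraph V) [DecidableRel G.Adj] {N : ℕ}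
    (e : V ≃ Fin N) : ∃ A : ℕ → ℕ → Bool, (∀ i j, A i j = A j i) ∧ (∀ i, A i i = false) ∧
      ∀ a b, A (e a) (e b) = decide (G.Adj a b) := by
  classical
  refine ⟨fun i j => decide (∃ a b : V, (e a : ℕ) = i ∧ (e b : ℕ) = j ∧ G.Adj a b),
    fun i j => ?_, fun i => ?_, fun a b => ?_⟩
  · rw [decide_eq_decide]
    constructor <;> exact fun ⟨a, b, ha, hb, hab⟩ => ⟨b, a, hb, ha, hab.symm⟩
  · rw [decide_eq_false_iff_not]
    rintro ⟨a, b, ha, hb, hab⟩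
    rw [← hb, Fin.val_inj, e.apply_eq_iff_eq] at ha
    exact hab.ne ha
  · rw [decide_eq_decide]
    refine ⟨?_, fun hab => ⟨a, b, rfl, rfl, hab⟩⟩
    rintro ⟨a', b', ha, hb, hab⟩
    rw [Fin.val_inj, e.apply_eq_iff_eq] at ha hb
    rwa [← ha, ← hb]

/-- A graph on `2 * n + 1` vertices cospectral with the friendship graph has its vertex degrees,
provided that a search over adjacency matrices confirms this. -/
theorem Cospectral.exists_degree_eq_of_search {V : Type*} [Fintype V] [DecidableEq V] {n : ℕ}
    (hn : 1 ≤ n) (hs : search admissible (friendshipDegrees n) (2 * n + 1) [] = true)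
    (G : SimpleGraph V) [DecidableRel G.Adj] (h : Cospectral G (friendshipGraph n)) :
    ∃ c, ∀ v, G.degree v = if v = c then 2 * n else 2 := by
  classical
  obtain ⟨hV, ⟨p, q, hpq⟩, h₂, h₃⟩ := h.exists_mul_self_apply hn
  have : Nonempty V := Fintype.card_pos_iff.1 (by omega)
  obtain ⟨c, hc⟩ := Finite.exists_max fun v => G.degree v
  let key : V → ℕ := fun v => if v = c then 0 else if G.Adj c v then 1 else 2
  obtain ⟨e, he⟩ := exists_equiv_fin_monotone hV key
  have hkey : ∀ a b, e a ≤ e b → key a ≤ key b := fun a b hab => by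
    simpa using he hab
  have hkey0 : ∀ a, key a = 0 ↔ a = c := fun a => by
    simp only [key]
    split_ifs <;> simp_all
  have hc0 : e c = 0 := by
    have h1 := hkey (e.symm 0) c (by simp)
    rw [(hkey0 c).2 rfl, Nat.le_zero, hkey0] at h1
    simp [← h1]
  obtain ⟨A, hsymm, hirr, hA⟩ := exists_bool_matrix G e
  have hsum : ∀ f : ℕ → ℕ, ∑ k ∈ Finset.range (2 * n + 1), f k = ∑ v, f (e v) := fun f => by
    rw [Finset.sum_range, ← e.sum_comp]
  have hidx : ∀ i < 2 * n + 1, ∃ a, (e a : ℕ) = i := fun i hi => ⟨e.symm ⟨i, hi⟩, by simp⟩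
  have hM : ∀ a b, (adjMat ℝ G * adjMat ℝ G) a b =
      (commonOnes A (2 * n + 1) (e a) (e b) : ℝ) := fun a b => by
    rw [adjMat_mul_self_apply, commonOnes, hsum]
    simp only [hA]
  have hdeg : ∀ a, commonOnes A (2 * n + 1) (e a) (e a) = G.degree a := fun a => by
    rw [commonOnes, hsum]
    simp only [hA, Bool.and_self, ← G.card_neighborFinset_eq_degree, G.neighborFinset_eq_filter,
      Finset.card_filter]
    exact Finset.sum_congr rfl fun v _ => by by_cases h : G.Adj a v <;> simp [h]
  have hpos : ∀ a, 1 ≤ commonOnes A (2 * n + 1) (e a) (e a) := fun a => by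
    have h1 := hM a a
    rw [hpq, if_pos rfl] at h1
    have h2 : (1 : ℝ) ≤ commonOnes A (2 * n + 1) (e a) (e a) := by
      nlinarith [mul_self_nonneg (p a), mul_self_nonneg (q a)]
    exact_mod_cast h2
  have hM' : ∀ a b, (commonOnes A (2 * n + 1) (e a) (e b) : ℝ) =
      (if a = b then 1 else 0) + p a * p b + q a * q b := fun a b => by rw [← hM, hpq]
  have hok : ∀ k ≤ 2 * n + 1, admissible (reverseRows A (2 * n + 1) k) = true := by
    intro k hk
    refine admissible_reverseRows hk ?_ ?_ ?_ ?_
    · intro i hi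
      obtain ⟨a, rfl⟩ := hidx i hi
      exact hpos a
    · intro i hi
      obtain ⟨a, rfl⟩ := hidx i hi
      have h1 := hdeg c
      rw [hc0, Fin.val_zero] at h1
      rw [hdeg, h1]
      exact hc a
    · intro i j hi hij hj
      obtain ⟨a, rfl⟩ := hidx i (hij.trans hj)
      obtain ⟨b, rfl⟩ := hidx j hj
      have h1 := hA c a
      have h2 := hA c b
      rw [hc0, Fin.val_zero] at h1 h2
      rw [h1, h2]
      have hac : a ≠ c := fun h => by simp [h, hc0] at hi
      have hbc : b ≠ c := fun h => by simp [h, hc0] at hij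
      have hab := hkey a b hij.le
      simp only [key, hac, hbc, if_false] at hab
      by_cases h3 : G.Adj c a
      · simp [h3, Bool.le_true]
      · by_cases h4 : G.Adj c b
        · simp [h3, h4] at hab
        · simp [h3, h4]
    · intro l j i hlj hji hi
      obtain ⟨x, rfl⟩ := hidx i hi
      obtain ⟨y, rfl⟩ := hidx j (hji.trans hi)
      obtain ⟨z, rfl⟩ := hidx l ((hlj.trans hji).trans hi)
      have hxy : x ≠ y := fun h => by simp [h] at hji
      have hyz : y ≠ z := fun h => by simp [h] at hlj
      have hxz : x ≠ z := fun h => by subst h; omega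
      refine isSingular_of_cast_eq (hpos x) (hpos y) (hpos z) (p := ![p x, p y, p z])
        (q := ![q x, q y, q z]) ?_ ?_ ?_ ?_ ?_ ?_ <;>
      simp [hM', hxy, hyz, hxz]
  obtain ⟨k, hk, hck⟩ := exists_of_friendshipDegrees (concl_of_search hsymm hirr hok hs)
    (by
      rw [hsum]
      simp only [Matrix.trace, Matrix.diag_apply, hM] at h₂
      exact_mod_cast h₂)
    (by
      simp only [hsum, hA]
      simp only [Matrix.trace, Matrix.diag_apply] at h₃
      rw [← Nat.cast_inj (R := ℝ)]
      push_cast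
      rw [← h₃]
      refine Finset.sum_congr rfl fun a _ => ?_
      rw [Matrix.mul_apply]
      refine Finset.sum_congr rfl fun b _ => ?_
      rw [hM, adjMat_apply, commonOnes, commonOnes]
      simp only [Bool.and_comm]
      by_cases hab : G.Adj a b <;> simp [hab])
  obtain ⟨c', rfl⟩ := hidx k hk
  refine ⟨c', fun v => ?_⟩
  rw [← hdeg, hck _ (e v).isLt]
  simp only [Fin.val_inj, e.apply_eq_iff_eq]

theorem Cospectral.nonempty_iso_of_search {V : Type*} [Fintype V] [DecidableEq V] {n : ℕ}
    (hn : 1 ≤ n) (hs : search admissible (friendshipDegrees n) (2 * n + 1) [] = true)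
    (G : SimpleGraph V) (h : Cospectral G (friendshipGraph n)) :
    Nonempty (G ≃g friendshipGraph n) := by
  classical
  obtain ⟨c, hc⟩ := h.exists_degree_eq_of_search hn hs G
  exact nonempty_iso_friendshipGraph_of_degree G (h.exists_mul_self_apply hn).1
    (by simpa using hc c) fun v hv => by simpa [hv] using hc v

theorem search_one : search admissible (friendshipDegrees 1) 3 [] = true := by
  decide +kernel

theorem search_two : search admissible (friendshipDegrees 2) 5 [] = true := by
  decide +kernel

theorem search_three : search admissible (friendshipDegrees 3) 7 [] = true := by
  decide +kernel

/-- for `n ∈ {1, 2, 3}`, the friendship graph `F n` is determined by its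
adjacency spectrum: every graph cospectral with `F n` is isomorphic to `F n`. -/
theorem friendship_one_two_three_DS :
    ∀ n ∈ ({1, 2, 3} : Set ℕ),
      ∀ (V : Type) [Fintype V] [DecidableEq V] (G : SimpleGraph V),
        Cospectral G (friendshipGraph n) → Nonempty (G ≃g friendshipGraph n) := by
  rintro n hn V _ _ G h
  rcases hn with rfl | rfl | rfl
  · exact h.nonempty_iso_of_search le_rfl search_one
  · exact h.nonempty_iso_of_search (by norm_num) search_two
  · exact h.nonempty_iso_of_search (by norm_num) search_three
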